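/- arXiv:1311.6733 — 11 statements merged into one kernel-verified Lean document; each statement's English description precedes it below -/
import Mathlib

section
/- For every integer q ≥ 2 and every integer a ≥ 3, one has 1 < (1 + q⁻¹)(1 − q⁻²) < ∏_{i=1}^{a} (1 − (−q)^{−i}) ≤ (1 + q⁻¹)(1 − q⁻²)(1 + q⁻³), where the product is taken over real numbers. -/
/-- The partial products `∏_{i=1}^{n} (1 − (−x)^i)` of even length are at least the one of length
two, and those of odd length at least three are at most the one of length three. -/
theorem prod_one_sub_neg_pow_bounds {x : ℝ} (hx : 0 < x) (hx' : x ≤ 1 / 2) (k : ℕ) :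
    (1 + x) * (1 - x ^ 2) ≤ ∏ i ∈ Finset.Icc 1 (2 * k + 2), (1 - (-x) ^ i) ∧
    ∏ i ∈ Finset.Icc 1 (2 * k + 3), (1 - (-x) ^ i) ≤ (1 + x) * (1 - x ^ 2) * (1 + x ^ 3) := by
  induction k with
  | zero =>
    norm_num [Finset.prod_Icc_succ_top]
    apply le_of_eq; ring
  | succ k ih =>
    obtain ⟨ih₁, ih₂⟩ := ih
    have hodd : (-x) ^ (2 * k + 3) = -x ^ (2 * k + 3) := Odd.neg_pow ⟨k + 1, by ring⟩ x
    have heven : (-x) ^ (2 * k + 4) = x ^ (2 * k + 4) := Even.neg_pow ⟨k + 2, by ring⟩ x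
    have hodd' : (-x) ^ (2 * k + 5) = -x ^ (2 * k + 5) := Odd.neg_pow ⟨k + 2, by ring⟩ x
    have h0 : 0 < (1 + x) * (1 - x ^ 2) := by
      have : 0 < 1 - x ^ 2 := by nlinarith
      positivity
    have hy : 0 < x ^ (2 * k + 3) := by positivity
    have hy' : x ^ (2 * k + 3) ≤ 1 := pow_le_one₀ hx.le (by linarith)
    rw [show 2 * (k + 1) + 2 = 2 * k + 3 + 1 by ring,
      show 2 * (k + 1) + 3 = 2 * k + 3 + 1 + 1 by ring,
      Finset.prod_Icc_succ_top (b := 2 * k + 3 + 1) (by omega),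
      Finset.prod_Icc_succ_top (b := 2 * k + 3) (by omega)]
    have hP : ∏ i ∈ Finset.Icc 1 (2 * k + 3), (1 - (-x) ^ i) =
        (∏ i ∈ Finset.Icc 1 (2 * k + 2), (1 - (-x) ^ i)) * (1 + x ^ (2 * k + 3)) := by
      rw [Finset.prod_Icc_succ_top (b := 2 * k + 2) (by omega), hodd, sub_neg_eq_add]
    rw [heven, hodd', sub_neg_eq_add, show x ^ (2 * k + 4) = x * x ^ (2 * k + 3) by ring,
      show x ^ (2 * k + 5) = x * (x * x ^ (2 * k + 3)) by ring]
    have hQ : 0 < ∏ i ∈ Finset.Icc 1 (2 * k + 3), (1 - (-x) ^ i) := by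
      rw [hP]; exact mul_pos (by linarith) (by linarith)
    generalize x ^ (2 * k + 3) = y at *
    have hxy : 0 < x * y := by positivity
    constructor
    · rw [hP, mul_assoc]
      refine ih₁.trans (le_mul_of_one_le_right (by linarith) ?_)
      nlinarith [mul_nonneg hy.le (by nlinarith : 0 ≤ 1 - x - x * y)]
    · rw [mul_assoc]
      refine (mul_le_of_le_one_right hQ.le ?_).trans ih₂
      nlinarith [mul_pos hx hxy, mul_pos hxy (mul_pos hx hxy)]

/-- For integers `q ≥ 2` and `a ≥ 3`,
`1 < (1 + q⁻¹)(1 − q⁻²) < ∏_{i=1}^{a} (1 − (−q)^{−i}) ≤ (1 + q⁻¹)(1 − q⁻²)(1 + q⁻³)`. -/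
theorem stmt_2 (q a : ℕ) (hq : 2 ≤ q) (ha : 3 ≤ a) :
    1 < (1 + (q : ℝ)⁻¹) * (1 - ((q : ℝ) ^ 2)⁻¹) ∧
    (1 + (q : ℝ)⁻¹) * (1 - ((q : ℝ) ^ 2)⁻¹) < ∏ i ∈ Finset.Icc 1 a, (1 - ((-(q : ℝ)) ^ i)⁻¹) ∧
    ∏ i ∈ Finset.Icc 1 a, (1 - ((-(q : ℝ)) ^ i)⁻¹) ≤
      (1 + (q : ℝ)⁻¹) * (1 - ((q : ℝ) ^ 2)⁻¹) * (1 + ((q : ℝ) ^ 3)⁻¹) := by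
  simp only [← inv_pow, inv_neg]
  have hq' : (2 : ℝ) ≤ q := by exact_mod_cast hq
  have hx : 0 < (q : ℝ)⁻¹ := by positivity
  have hx' : (q : ℝ)⁻¹ ≤ 1 / 2 := by
    rw [one_div]; exact inv_anti₀ (by norm_num) hq'
  generalize (q : ℝ)⁻¹ = x at *
  have h1 : 1 < (1 + x) * (1 - x ^ 2) := by
    nlinarith [mul_pos hx (by nlinarith : 0 < 1 - x - x ^ 2)]
  refine ⟨h1, ?_⟩
  obtain ⟨k, rfl | rfl⟩ : ∃ k, a = 2 * k + 3 ∨ a = 2 * k + 3 + 1 :=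
    ⟨(a - 3) / 2, by omega⟩
  all_goals
    obtain ⟨hl, hu⟩ := prod_one_sub_neg_pow_bounds hx hx' k
    have hodd : (-x) ^ (2 * k + 3) = -x ^ (2 * k + 3) := Odd.neg_pow ⟨k + 1, by ring⟩ x
    have hP : ∏ i ∈ Finset.Icc 1 (2 * k + 3), (1 - (-x) ^ i) =
        (∏ i ∈ Finset.Icc 1 (2 * k + 2), (1 - (-x) ^ i)) * (1 + x ^ (2 * k + 3)) := by
      rw [Finset.prod_Icc_succ_top (b := 2 * k + 2) (by omega), hodd, sub_neg_eq_add]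
    have hy : 0 < x ^ (2 * k + 3) := by positivity
  · refine ⟨?_, hu⟩
    rw [hP]
    exact hl.trans_lt (lt_mul_of_one_lt_right (by linarith) (by linarith))
  · have heven : (-x) ^ (2 * k + 3 + 1) = x * x ^ (2 * k + 3) := by
      rw [Even.neg_pow ⟨k + 2, by ring⟩ x, pow_succ']
    have hy' : x ^ (2 * k + 3) < 1 := pow_lt_one₀ hx.le (by linarith) (by omega)
    rw [Finset.prod_Icc_succ_top (b := 2 * k + 3) (by omega), heven]
    generalize x ^ (2 * k + 3) = y at *
    have hxy : 0 < x * y := by positivity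
    constructor
    · rw [hP, mul_assoc]
      refine hl.trans_lt (lt_mul_of_one_lt_right (by linarith) ?_)
      nlinarith [mul_pos hy (by nlinarith : 0 < 1 - x - x * y)]
    · refine (mul_le_of_le_one_right ?_ (by linarith)).trans hu
      rw [hP]; exact mul_nonneg (by linarith) (by linarith)
end

section
/- Let F be a finite field with |F| = q and let l ≥ 2 be an integer; set a = 2l. Then (1 − q⁻² − q⁻⁴)·q^{a(a+1)/2} < |Sp_a(F)| ≤ (1 − q⁻²)(1 − q⁻⁴)·q^{a(a+1)/2}. -/
namespace SymplecticCount

open Matrix LinearMap Module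

variable {F V : Type*} [Field F] [AddCommGroup V] [Module F V]

/-- Families of vectors of `V` whose Gram matrix with respect to `B` is the standard
symplectic matrix `J`. -/
abbrev SymplecticFamily (B : LinearMap.BilinForm F V) (l : ℕ) : Type _ :=
  {v : Fin l ⊕ Fin l → V // ∀ i j, B (v i) (v j) = J (Fin l) F i j}

/-- The vectors orthogonal to both `e` and `f`. -/
abbrev pairOrthogonal (B : LinearMap.BilinForm F V) (e f : V) : Submodule F V :=
  LinearMap.ker ((B e).prod (B f))

theorem mem_pairOrthogonal {B : LinearMap.BilinForm F V} {e f w : V} :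
    w ∈ pairOrthogonal B e f ↔ B e w = 0 ∧ B f w = 0 := by
  simp [LinearMap.mem_ker]

theorem finrank_pairOrthogonal [FiniteDimensional F V] {B : LinearMap.BilinForm F V} (hB : B.IsAlt)
    {e f : V} (hef : B e f = -1) :
    finrank F (pairOrthogonal B e f) + 2 = finrank F V := by
  have hfe : B f e = 1 := by rw [← hB.neg_eq, hef, neg_neg]
  have hsurj : Function.Surjective ((B e).prod (B f)) := fun ⟨x, y⟩ ↦
    ⟨y • e - x • f, by simp [hef, hfe, hB e, hB f]⟩
  have h := LinearMap.finrank_range_add_finrank_ker ((B e).prod (B f))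
  rw [LinearMap.range_eq_top.2 hsurj, finrank_top, Module.finrank_prod, finrank_self] at h
  change _ + finrank F (pairOrthogonal B e f) = _ at h
  omega

theorem restrict_pairOrthogonal_nondegenerate {B : LinearMap.BilinForm F V} (hB : B.IsAlt)
    (hn : B.Nondegenerate) {e f : V} (hef : B e f = -1) :
    (B.restrict (pairOrthogonal B e f)).Nondegenerate := by
  have hfe : B f e = 1 := by rw [← hB.neg_eq, hef, neg_neg]
  have hr : (B.restrict (pairOrthogonal B e f)).IsRefl := fun x y h ↦ hB.isRefl x y h
  refine (LinearMap.IsRefl.nondegenerate_iff_separatingLeft hr).2 ?_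
  rintro ⟨w, hw⟩ h
  obtain ⟨h1, h2⟩ := mem_pairOrthogonal.1 hw
  refine Subtype.ext (hn.1 w fun v ↦ ?_)
  have hwe := hB.isRefl _ _ h1
  have hwf := hB.isRefl _ _ h2
  have hv : v - B f v • e + B e v • f ∈ pairOrthogonal B e f := by
    rw [mem_pairOrthogonal]
    simp [hef, hfe, hB e, hB f]
  have := h ⟨_, hv⟩
  simpa [hwe, hwf] using this

/-- A symplectic family is a hyperbolic pair together with a symplectic family in its
orthogonal complement. -/
def symplecticFamilySuccEquiv {B : LinearMap.BilinForm F V} (hB : B.IsAlt) (l : ℕ) :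
    SymplecticFamily B (l + 1) ≃
      Σ p : {p : V × V // B p.1 p.2 = -1},
        SymplecticFamily (B.restrict (pairOrthogonal B p.1.1 p.1.2)) l where
  toFun v := ⟨⟨(v.1 (.inl 0), v.1 (.inr 0)), by simp [v.2, J]⟩,
    ⟨fun i ↦ ⟨v.1 (i.map Fin.succ Fin.succ), by
      rw [mem_pairOrthogonal]
      rcases i with i | i <;> simp [v.2, J, (Fin.succ_ne_zero _).symm]⟩,
    by
      intro i j
      rcases i with i | i <;> rcases j with j | j <;>
        simp [v.2, J, Matrix.one_apply]⟩⟩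
  invFun p := ⟨Sum.elim (Fin.cons p.1.1.1 fun i ↦ (p.2.1 (.inl i) : V))
      (Fin.cons p.1.1.2 fun i ↦ (p.2.1 (.inr i) : V)), by
    obtain ⟨⟨⟨e, f⟩, hef⟩, ⟨v, hv⟩⟩ := p
    have hfe : B f e = 1 := by rw [← hB.neg_eq, hef, neg_neg]
    have h i := mem_pairOrthogonal.1 (v i).2
    have h1 i : B e (v i) = 0 := (h i).1
    have h2 i : B f (v i) = 0 := (h i).2
    have h3 i : B (v i) e = 0 := hB.isRefl _ _ (h1 i)
    have h4 i : B (v i) f = 0 := hB.isRefl _ _ (h2 i)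
    have h5 i j : B (v i) (v j) = J (Fin l) F i j := hv i j
    intro i j
    rcases i with i | i <;> rcases j with j | j <;>
      cases i using Fin.cases <;> cases j using Fin.cases <;>
      simp_all [J, Matrix.one_apply, hB e, hB f, Fin.succ_ne_zero, (Fin.succ_ne_zero _).symm]⟩
  left_inv v := by
    apply Subtype.ext
    funext i
    rcases i with i | i <;> cases i using Fin.cases <;> rfl
  right_inv p := by
    obtain ⟨⟨⟨e, f⟩, hef⟩, ⟨v, hv⟩⟩ := p
    refine Sigma.ext rfl (heq_of_eq (Subtype.ext (funext fun i ↦ ?_)))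
    rcases i with i | i <;> rfl

theorem card_fiber_mul_card [Finite V] {φ : V →ₗ[F] F} (hφ : φ ≠ 0) (c : F) :
    Nat.card {v // φ v = c} * Nat.card F = Nat.card V := by
  have hs := LinearMap.surjective hφ
  have key (d : F) : Nat.card {v // φ v = d} = Nat.card {v // φ v = c} := by
    obtain ⟨u, hu⟩ := hs (c - d)
    refine Nat.card_congr ((Equiv.addRight u).subtypeEquiv fun v ↦ ?_)
    simp [hu, ← eq_sub_iff_add_eq]
  have : Finite F := Finite.of_surjective _ hs
  have := Fintype.ofFinite F
  rw [← Nat.card_congr (Equiv.sigmaFiberEquiv φ), Nat.card_sigma]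
  simp [key, mul_comm]

theorem card_hyperbolicPair_mul_card [Finite V] {B : LinearMap.BilinForm F V} (hn : B.Nondegenerate) :
    Nat.card {p : V × V // B p.1 p.2 = -1} * Nat.card F
      = (Nat.card V - 1) * Nat.card V := by
  classical
  have := Fintype.ofFinite V
  let E : {p : V × V // B p.1 p.2 = -1} ≃ Σ e : {e : V // e ≠ 0}, {f // B e.1 f = -1} :=
    { toFun p := ⟨⟨p.1.1, by rintro h; simpa [h] using p.2⟩, ⟨p.1.2, p.2⟩⟩
      invFun p := ⟨(p.1.1, p.2.1), p.2.2⟩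
      left_inv _ := rfl
      right_inv _ := rfl }
  have h (e : {e : V // e ≠ 0}) :
      Nat.card {f // B e.1 f = -1} * Nat.card F = Nat.card V := by
    refine card_fiber_mul_card (fun h0 ↦ e.2 (hn.1 _ fun v ↦ ?_)) _
    rw [h0, LinearMap.zero_apply]
  rw [Nat.card_congr E, Nat.card_sigma, Finset.sum_mul, Finset.sum_congr rfl fun e _ ↦ h e]
  simp [Fintype.card_subtype_compl]

theorem card_symplecticFamily [Finite F] (l : ℕ) :
    ∀ {V : Type*} [AddCommGroup V] [Module F V] [FiniteDimensional F V] {B : LinearMap.BilinForm F V},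
      B.IsAlt → B.Nondegenerate → finrank F V = 2 * l →
      Nat.card (SymplecticFamily B l) =
        Nat.card F ^ l ^ 2 * ∏ i ∈ Finset.range l, (Nat.card F ^ (2 * (i + 1)) - 1) := by
  induction l with
  | zero =>
    intro V _ _ _ B _ _ _
    have : Unique (SymplecticFamily B 0) :=
      { default := ⟨isEmptyElim, isEmptyElim⟩
        uniq := fun _ ↦ Subtype.ext (Subsingleton.elim _ _) }
    simp
  | succ l ih =>
    intro V _ _ _ B hB hn hV
    have : Finite V := Module.finite_of_finite F
    have := Fintype.ofFinite V
    have := Fintype.ofFinite {p : V × V // B p.1 p.2 = -1}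
    rw [Nat.card_congr (symplecticFamilySuccEquiv hB l), Nat.card_sigma,
      Finset.sum_congr rfl fun p _ ↦ ih (B := B.restrict (pairOrthogonal B p.1.1 p.1.2))
        (fun x ↦ hB x) (restrict_pairOrthogonal_nondegenerate hB hn p.2)
        (by have := finrank_pairOrthogonal hB p.2; omega)]
    have h := card_hyperbolicPair_mul_card hn
    rw [Module.natCard_eq_pow_finrank (K := F) (V := V), hV] at h
    have hF : 0 < Nat.card F := Nat.card_pos
    apply Nat.eq_of_mul_eq_mul_right hF
    rw [Finset.sum_const, Finset.card_univ, ← Nat.card_eq_fintype_card, smul_eq_mul,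
      mul_right_comm, h, Finset.prod_range_succ]
    ring

theorem card_symplecticGroup [Finite F] (l : ℕ) :
    Nat.card (symplecticGroup (Fin l) F) =
      Nat.card F ^ l ^ 2 * ∏ i ∈ Finset.range l, (Nat.card F ^ (2 * (i + 1)) - 1) := by
  have hJ : IsUnit (J (Fin l) F).det := isUnit_det_J _ _
  let B : LinearMap.BilinForm F (Fin l ⊕ Fin l → F) := Matrix.toBilin' (J (Fin l) F)
  have hB : B.IsAlt := fun x ↦ by
    simp [B, Matrix.toBilin'_apply', J, Matrix.fromBlocks_mulVec, dotProduct, Matrix.neg_mulVec,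
      mul_comm]
  have hn : B.Nondegenerate :=
    LinearMap.BilinForm.nondegenerate_toBilin'_of_det_ne_zero' _ hJ.ne_zero
  rw [← card_symplecticFamily l hB hn (by simp [two_mul])]
  refine Nat.card_congr (Equiv.subtypeEquiv (Equiv.refl _) fun A ↦ ?_)
  rw [SymplecticGroup.mem_iff, ← Matrix.ext_iff]
  refine forall₂_congr fun i j ↦ ?_
  rw [Matrix.mul_assoc, Matrix.toBilin'_apply']
  rfl

end SymplecticCount

theorem one_sub_sub_add_le_prod_one_sub_pow {x : ℝ} (h0 : 0 ≤ x) (h1 : x ≤ 1) {l : ℕ}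
    (hl : 2 ≤ l) :
    1 - x - x ^ 2 + x ^ (l + 1) ≤ ∏ i ∈ Finset.range l, (1 - x ^ (i + 1)) := by
  induction l, hl using Nat.le_induction with
  | base => simp only [Finset.prod_range_succ, Finset.prod_range_zero]; apply le_of_eq; ring
  | succ l hl ih =>
    rw [Finset.prod_range_succ]
    have h2 : x ^ (l + 1) ≤ 1 := pow_le_one₀ h0 h1
    have h3 : x ^ (2 * l + 2) ≤ x ^ (l + 3) := pow_le_pow_of_le_one h0 h1 (by omega)
    have h4 := mul_le_mul_of_nonneg_right ih (sub_nonneg.2 h2)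
    refine le_trans (le_of_sub_nonneg ?_) h4
    ring_nf at h3 ⊢
    linarith

theorem prod_one_sub_pow_le {x : ℝ} (h0 : 0 ≤ x) (h1 : x ≤ 1) {l : ℕ} (hl : 2 ≤ l) :
    ∏ i ∈ Finset.range l, (1 - x ^ (i + 1)) ≤ (1 - x) * (1 - x ^ 2) := by
  have h := Finset.prod_le_prod_of_subset_of_le_one (f := fun i ↦ 1 - x ^ (i + 1))
    (Finset.range_mono hl) (fun i _ ↦ sub_nonneg.2 (pow_le_one₀ h0 h1))
    (fun i _ _ ↦ sub_le_self _ (pow_nonneg h0 _))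
  simpa [Finset.prod_range_succ] using h

/-- If `F` is a finite field with `|F| = q`, `l ≥ 2` and `a = 2l`, then
`(1 − q⁻² − q⁻⁴)·q^{a(a+1)/2} < |Sp_a(F)| ≤ (1 − q⁻²)(1 − q⁻⁴)·q^{a(a+1)/2}`. -/
theorem stmt_4 (F : Type*) [Field F] [Fintype F] (q l : ℕ)
    (hq : Fintype.card F = q) (hl : 2 ≤ l) :
    (1 - ((q : ℝ) ^ 2)⁻¹ - ((q : ℝ) ^ 4)⁻¹) * (q : ℝ) ^ ((2 * l) * (2 * l + 1) / 2) <
      Nat.card (Matrix.symplecticGroup (Fin l) F) ∧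
    (Nat.card (Matrix.symplecticGroup (Fin l) F) : ℝ) ≤
      (1 - ((q : ℝ) ^ 2)⁻¹) * (1 - ((q : ℝ) ^ 4)⁻¹) * (q : ℝ) ^ ((2 * l) * (2 * l + 1) / 2) := by
  have hq1 : 1 < q := hq ▸ Fintype.one_lt_card
  have hq0 : (0 : ℝ) < q := by exact_mod_cast hq1.le
  obtain ⟨x, hx⟩ : ∃ x : ℝ, x = ((q : ℝ) ^ 2)⁻¹ := ⟨_, rfl⟩
  have hx0 : 0 < x := hx ▸ by positivity
  have hx1 : x ≤ 1 := hx ▸ inv_le_one_of_one_le₀ (one_le_pow₀ (by exact_mod_cast hq1.le))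
  have hx2 : ((q : ℝ) ^ 4)⁻¹ = x ^ 2 := by rw [hx, inv_pow, ← pow_mul]
  have hcard : (Nat.card (Matrix.symplecticGroup (Fin l) F) : ℝ) =
      (∏ i ∈ Finset.range l, (1 - x ^ (i + 1))) * (q : ℝ) ^ ((2 * l) * (2 * l + 1) / 2) := by
    have hexp : (2 * l) * (2 * l + 1) / 2 = l ^ 2 + ∑ i ∈ Finset.range l, 2 * (i + 1) := by
      have : ∑ i ∈ Finset.range l, 2 * (i + 1) = l * (l + 1) := by
        clear hl
        induction l with
        | zero => rfl
        | succ l ih => rw [Finset.sum_range_succ, ih]; ring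
      rw [this, mul_assoc, Nat.mul_div_cancel_left _ two_pos]
      ring
    rw [SymplecticCount.card_symplecticGroup, Nat.card_eq_fintype_card, hq, hexp, pow_add,
      ← Finset.prod_pow_eq_pow_sum, mul_left_comm, ← Finset.prod_mul_distrib]
    push_cast
    congr 1
    refine Finset.prod_congr rfl fun i _ ↦ ?_
    rw [Nat.cast_sub (Nat.one_le_pow _ _ hq1.le), hx, inv_pow, ← pow_mul]
    push_cast
    field_simp
  rw [hx2, ← hx, hcard]
  refine ⟨mul_lt_mul_of_pos_right ?_ (by positivity),
    mul_le_mul_of_nonneg_right (prod_one_sub_pow_le hx0.le hx1 hl) (by positivity)⟩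
  have := pow_pos hx0 (l + 1)
  linarith [one_sub_sub_add_le_prod_one_sub_pow hx0.le hx1 hl]
end

section
/- Let F be a finite field with |F| = q and let n ≥ 2 be an integer. Then q^{n²−2} < |PSL_n(F)| ≤ (1 − q⁻²)·q^{n²−1}. -/
open Matrix in
/-- The special linear group is the kernel of the determinant on the general linear group, so
`|SL_n(F)| (|F| - 1) = |GL_n(F)|`. -/
theorem card_specialLinearGroup_mul_card_units (F : Type*) [Field F] [Fintype F] (n : ℕ)
    (hn : 0 < n) :
    Nat.card (SpecialLinearGroup (Fin n) F) * Nat.card Fˣ = Nat.card (GL (Fin n) F) := by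
  have : NeZero n := ⟨hn.ne'⟩
  let f : GL (Fin n) F →* Fˣ := GeneralLinearGroup.det
  have hf : Function.Surjective f := GeneralLinearGroup.det_surjective
  have hker : Nat.card (SpecialLinearGroup (Fin n) F) = Nat.card f.ker := by
    refine Nat.card_congr (Equiv.ofBijective
      (fun A => ⟨SpecialLinearGroup.toGL A, ?_⟩) ⟨?_, ?_⟩)
    · rw [MonoidHom.mem_ker]
      ext
      simp [f]
    · intro A B h
      ext i j
      exact congrArg (fun C : f.ker => (C : GL (Fin n) F) i j) h
    · rintro ⟨A, hA⟩
      refine ⟨⟨A, by simpa [f] using congrArg Units.val (MonoidHom.mem_ker.mp hA)⟩, ?_⟩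
      ext i j
      rfl
  rw [hker, ← Subgroup.card_mul_index f.ker, Subgroup.index_ker,
    MonoidHom.range_eq_top.mpr hf, Subgroup.card_top]

/-- The center of `SL_n(F)` is isomorphic to a group of roots of unity, hence embeds in `Fˣ`. -/
theorem card_center_specialLinearGroup_le (F : Type*) [Field F] [Fintype F] (n : ℕ) :
    Nat.card (Subgroup.center (Matrix.SpecialLinearGroup (Fin n) F)) ≤ Nat.card Fˣ := by
  rw [Nat.card_congr (Matrix.SpecialLinearGroup.center_equiv_rootsOfUnity (n := Fin n)
    (R := F)).toEquiv]
  exact Nat.card_le_card_of_injective _ Subtype.val_injective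

theorem one_sub_add_pow_le_prod_one_sub_pow {x : ℝ} (hx0 : 0 ≤ x) (hx : x ≤ 1 / 2) (k : ℕ) :
    1 - x + x ^ (k + 1) ≤ ∏ j ∈ Finset.range k, (1 - x ^ (j + 2)) := by
  induction k with
  | zero => simp
  | succ k ih =>
    rw [Finset.prod_range_succ]
    have h1 : x ^ (k + 2) ≤ 1 := pow_le_one₀ hx0 (by linarith)
    have h2 : x ^ (k + 1) ≤ x := by
      simpa using pow_le_pow_of_le_one hx0 (by linarith) (Nat.le_add_left 1 k)
    have h3 : x ^ (k + 2) ≤ x ^ (k + 1) / 2 := by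
      rw [pow_succ x (k + 1)]
      nlinarith [pow_nonneg hx0 (k + 1)]
    have h4 := mul_le_mul_of_nonneg_right ih (sub_nonneg.mpr h1)
    nlinarith [pow_nonneg hx0 (k + 2)]

/-- `|SL_n(F)| = q^{n²-1} ∏_{i=2}^n (1 - q^{-i})`. -/
theorem card_specialLinearGroup (F : Type*) [Field F] [Fintype F] (n : ℕ) (hn : 0 < n) :
    (Nat.card (Matrix.SpecialLinearGroup (Fin n) F) : ℝ) = (Fintype.card F : ℝ) ^ (n ^ 2 - 1) *
      ∏ j ∈ Finset.range (n - 1), (1 - ((Fintype.card F : ℝ)⁻¹) ^ (j + 2)) := by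
  set q := Fintype.card F with hq
  have hq1 : 1 < q := Fintype.one_lt_card
  have hqR : (1 : ℝ) < q := by exact_mod_cast hq1
  have hq0 : (q : ℝ) ≠ 0 := by positivity
  have hprod : (Nat.card (Matrix.GeneralLinearGroup (Fin n) F) : ℝ) =
      (q : ℝ) ^ n ^ 2 * ∏ j ∈ Finset.range n, (1 - ((q : ℝ)⁻¹) ^ (j + 1)) := by
    rw [Matrix.card_GL_field, ← hq, Nat.cast_prod, pow_two, pow_mul,
      ← Finset.prod_range_reflect, ← Fin.prod_univ_eq_prod_range
        (fun j => 1 - ((q : ℝ)⁻¹) ^ (n - 1 - j + 1)) n]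
    have hconst : ((q : ℝ) ^ n) ^ n = ∏ _i : Fin n, (q : ℝ) ^ n := by simp
    rw [hconst, ← Finset.prod_mul_distrib]
    refine Finset.prod_congr rfl fun i _ => ?_
    rw [Nat.cast_sub (Nat.pow_le_pow_right hq1.le i.2.le)]
    push_cast
    have hi : (q : ℝ) ^ n = (q : ℝ) ^ (i : ℕ) * (q : ℝ) ^ (n - 1 - i + 1) := by
      rw [← pow_add]
      congr 1
      omega
    rw [hi, inv_pow]
    field_simp
  have hcard := congrArg (Nat.cast : ℕ → ℝ) (card_specialLinearGroup_mul_card_units F n hn)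
  obtain ⟨m, rfl⟩ := Nat.exists_eq_add_of_le' hn
  rw [hprod, Nat.cast_mul, Nat.card_units, Nat.card_eq_fintype_card (α := F), ← hq,
    Nat.cast_sub hq1.le, Nat.cast_one, Finset.prod_range_succ'] at hcard
  have hpow : (q : ℝ) ^ (m + 1) ^ 2 = (q : ℝ) ^ ((m + 1) ^ 2 - 1) * q := by
    rw [← pow_succ, Nat.sub_add_cancel (Nat.one_le_pow _ _ hn)]
  refine mul_right_cancel₀ (sub_ne_zero.mpr hqR.ne') (hcard.trans ?_)
  rw [hpow, Nat.add_sub_cancel, zero_add, pow_one]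
  field_simp

/-- If `F` is a finite field with `|F| = q` and `n ≥ 2`, then
`q^{n²−2} < |PSL_n(F)| ≤ (1 − q⁻²)·q^{n²−1}`. -/
theorem stmt_5 (F : Type*) [Field F] [Fintype F] (q n : ℕ)
    (hq : Fintype.card F = q) (hn : 2 ≤ n) :
    (q : ℝ) ^ (n ^ 2 - 2) <
      Nat.card (Matrix.SpecialLinearGroup (Fin n) F ⧸
        Subgroup.center (Matrix.SpecialLinearGroup (Fin n) F)) ∧
    (Nat.card (Matrix.SpecialLinearGroup (Fin n) F ⧸
        Subgroup.center (Matrix.SpecialLinearGroup (Fin n) F)) : ℝ) ≤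
      (1 - ((q : ℝ) ^ 2)⁻¹) * (q : ℝ) ^ (n ^ 2 - 1) := by
  have hSL := card_specialLinearGroup F n (by omega)
  have hZ : (Nat.card (Subgroup.center (Matrix.SpecialLinearGroup (Fin n) F)) : ℝ) ≤ q - 1 := by
    have hq1 : 1 ≤ q := hq ▸ Fintype.card_pos
    have h := card_center_specialLinearGroup_le F n
    rw [Nat.card_units, Nat.card_eq_fintype_card (α := F), hq] at h
    rw [← Nat.cast_one, ← Nat.cast_sub hq1]
    exact_mod_cast h
  have hZ1 : (1 : ℝ) ≤ Nat.card (Subgroup.center (Matrix.SpecialLinearGroup (Fin n) F)) := by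
    exact_mod_cast Nat.one_le_iff_ne_zero.mpr Nat.card_pos.ne'
  rw [Subgroup.card_eq_card_quotient_mul_card_subgroup
    (Subgroup.center (Matrix.SpecialLinearGroup (Fin n) F)), hq, Nat.cast_mul] at hSL
  have hqR : (2 : ℝ) ≤ q := by exact_mod_cast hq ▸ Fintype.one_lt_card (α := F)
  have hq0 : (0 : ℝ) < q := by linarith
  set P : ℝ := (Nat.card (Matrix.SpecialLinearGroup (Fin n) F ⧸
    Subgroup.center (Matrix.SpecialLinearGroup (Fin n) F)) : ℝ)
  set z : ℝ := (Nat.card (Subgroup.center (Matrix.SpecialLinearGroup (Fin n) F)) : ℝ)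
  have hP0 : 0 ≤ P := Nat.cast_nonneg _
  have hx0 : 0 < (q : ℝ)⁻¹ := inv_pos.mpr hq0
  have hx : (q : ℝ)⁻¹ ≤ 1 / 2 := by
    rw [one_div]
    exact inv_anti₀ two_pos hqR
  have hsq : 4 ≤ n ^ 2 := by nlinarith
  constructor
  · have hlow := one_sub_add_pow_le_prod_one_sub_pow hx0.le hx (n - 1)
    have hpow : (q : ℝ) ^ (n ^ 2 - 1) = (q : ℝ) ^ (n ^ 2 - 2) * q := by
      rw [← pow_succ]
      congr 1
      omega
    have hlt : (q : ℝ) ^ (n ^ 2 - 2) * (q - 1) < P * z := by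
      have heq : (q : ℝ) ^ (n ^ 2 - 2) * (q - 1) = q ^ (n ^ 2 - 1) * (1 - (q : ℝ)⁻¹) := by
        rw [hpow]
        field_simp
      rw [hSL, heq]
      have := pow_pos hx0 (n - 1 + 1)
      exact mul_lt_mul_of_pos_left (by linarith) (by positivity)
    have hle := mul_le_mul_of_nonneg_left hZ (pow_nonneg hq0.le (n ^ 2 - 2))
    exact lt_of_mul_lt_mul_right (hle.trans_lt hlt) (by linarith)
  · obtain ⟨m, rfl⟩ := Nat.exists_eq_add_of_le' hn
    have hle : P ≤ P * z := le_mul_of_one_le_right hP0 hZ1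
    have hx2 : (q : ℝ)⁻¹ ^ 2 ≤ 1 := pow_le_one₀ hx0.le (by linarith)
    have hprod : ∏ j ∈ Finset.range m, (1 - (q : ℝ)⁻¹ ^ (j + 1 + 2)) ≤ 1 := by
      refine Finset.prod_le_one (fun j _ => ?_) fun j _ => ?_
      · exact sub_nonneg.mpr (pow_le_one₀ hx0.le (by linarith))
      · exact sub_le_self _ (by positivity)
    rw [hSL, show m + 2 - 1 = m + 1 from rfl, Finset.prod_range_succ'] at hle
    refine hle.trans ?_
    rw [mul_comm, ← inv_pow]
    refine mul_le_mul_of_nonneg_right ?_ (by positivity)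
    exact mul_le_of_le_one_left (sub_nonneg.mpr hx2) hprod
end

section
/- Let F be a finite field with |F| = q, let l ≥ 2 be an integer, and set n = 2l and α = gcd(2, q − 1). Then (1/(2α))·q^{n(n+1)/2} < |PSp_n(F)| < q^{n(n+1)/2}. -/
open Matrix

section Counting

variable {F V : Type*} [Field F] [AddCommGroup V] [Module F V]

/-- A family of pairs `(aᵢ, bᵢ)` that are mutually orthogonal hyperbolic pairs for `B`. -/
def IsSymplecticFamily (B : V →ₗ[F] V →ₗ[F] F) {m : ℕ} (f : Fin m → V × V) : Prop :=
  ∀ i j, B (f i).1 (f j).1 = 0 ∧ B (f i).2 (f j).2 = 0 ∧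
    B (f i).1 (f j).2 = if i = j then 1 else 0

/-- The pairings of a vector with all members of a family of pairs. -/
def pairingMap (B : V →ₗ[F] V →ₗ[F] F) {m : ℕ} (f : Fin m → V × V) :
    V →ₗ[F] (Fin m → F) × (Fin m → F) :=
  (LinearMap.pi fun i ↦ B (f i).1).prod (LinearMap.pi fun i ↦ B (f i).2)

theorem mem_ker_pairingMap {B : V →ₗ[F] V →ₗ[F] F} {m : ℕ} {f : Fin m → V × V} {x : V} :
    x ∈ (pairingMap B f).ker ↔ ∀ i, B (f i).1 x = 0 ∧ B (f i).2 x = 0 := by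
  simp [pairingMap, funext_iff, forall_and]

theorem LinearMap.IsAlt.apply_eq_zero_comm {B : V →ₗ[F] V →ₗ[F] F} (hB : B.IsAlt) {x y : V} :
    B x y = 0 ↔ B y x = 0 := by
  rw [← hB.neg x y, neg_eq_zero]

theorem IsSymplecticFamily.exists_pairingMap_eq {B : V →ₗ[F] V →ₗ[F] F} (hB : B.IsAlt) {m : ℕ}
    {f : Fin m → V × V} (hf : IsSymplecticFamily B f) (c : (Fin m → F) × (Fin m → F)) :
    ∃ z, pairingMap B f z = c ∧ ∀ x ∈ (pairingMap B f).ker, B x z = 0 := by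
  refine ⟨∑ i, (c.1 i • (f i).2 - c.2 i • (f i).1), ?_, fun x hx ↦ ?_⟩
  · have h21 (i j) : B (f i).2 (f j).1 = -if j = i then 1 else 0 := by
      rw [← hB.neg, (hf j i).2.2]
    ext j
    · simp [pairingMap, (hf j _).1, (hf j _).2.2]
    · simp [pairingMap, h21, (hf j _).2.1]
  · have h (i) : B x (f i).1 = 0 ∧ B x (f i).2 = 0 := by
      rw [hB.apply_eq_zero_comm, hB.apply_eq_zero_comm (x := x)]
      exact mem_ker_pairingMap.1 hx i
    simp [h]

theorem IsSymplecticFamily.card_ker_pairingMap {B : V →ₗ[F] V →ₗ[F] F} (hB : B.IsAlt) {m : ℕ}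
    {f : Fin m → V × V} (hf : IsSymplecticFamily B f) :
    Nat.card (pairingMap B f).ker * Nat.card F ^ (2 * m) = Nat.card V := by
  have hs : Function.Surjective (pairingMap B f) := fun c ↦
    (hf.exists_pairingMap_eq hB c).imp fun _ h ↦ h.1
  rw [Submodule.card_eq_card_quotient_mul_card (pairingMap B f).ker,
    Nat.card_congr ((pairingMap B f).quotKerEquivOfSurjective hs).toEquiv]
  rw [Nat.card_prod, Nat.card_fun, Nat.card_fin, ← pow_add, ← two_mul, mul_comm]

theorem IsSymplecticFamily.exists_mem_ker_pairingMap_apply_ne_zero {B : V →ₗ[F] V →ₗ[F] F}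
    (hB : B.IsAlt) (hB' : B.SeparatingLeft) {m : ℕ} {f : Fin m → V × V}
    (hf : IsSymplecticFamily B f) {x : V} (hx : x ∈ (pairingMap B f).ker) (hx0 : x ≠ 0) :
    ∃ y ∈ (pairingMap B f).ker, B x y ≠ 0 := by
  obtain ⟨y, hy⟩ : ∃ y, B x y ≠ 0 := by
    by_contra! h
    exact hx0 (hB' x h)
  obtain ⟨z, hz, hxz⟩ := hf.exists_pairingMap_eq hB (pairingMap B f y)
  exact ⟨y - z, by simp [hz], by simpa [hxz x hx] using hy⟩

theorem card_apply_eq_one_mul_card {φ : V →ₗ[F] F} (hφ : φ ≠ 0) :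
    Nat.card {y // φ y = 1} * Nat.card F = Nat.card V := by
  have hs := LinearMap.surjective hφ
  obtain ⟨z, hz⟩ := hs 1
  have e : {y // φ y = 1} ≃ φ.ker := (Equiv.subRight z).subtypeEquiv fun y ↦ by
    simp [hz, sub_eq_zero]
  rw [Submodule.card_eq_card_quotient_mul_card φ.ker,
    Nat.card_congr (φ.quotKerEquivOfSurjective hs).toEquiv, Nat.card_congr e, mul_comm]

theorem card_hyperbolicPair_mul_card [Finite V] {B : V →ₗ[F] V →ₗ[F] F} (hB : B.SeparatingLeft) :
    Nat.card {p : V × V // B p.1 p.2 = 1} * Nat.card F = (Nat.card V - 1) * Nat.card V := by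
  have := Fintype.ofFinite V
  classical
  let e : {p : V × V // B p.1 p.2 = 1} ≃ Σ x : {x : V // x ≠ 0}, {y // B x y = 1} :=
    { toFun p := ⟨⟨p.1.1, fun h ↦ by simpa [h] using p.2⟩, p.1.2, p.2⟩
      invFun s := ⟨(s.1, s.2), s.2.2⟩
      left_inv _ := rfl
      right_inv _ := rfl }
  rw [Nat.card_congr e, Nat.card_sigma, Finset.sum_mul, Finset.sum_congr rfl fun x _ ↦
    card_apply_eq_one_mul_card fun h ↦ x.2 (hB x fun y ↦ by simp [h])]
  simp

theorem isSymplecticFamily_cons {B : V →ₗ[F] V →ₗ[F] F} (hB : B.IsAlt) {m : ℕ} {p : V × V}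
    {f : Fin m → V × V} : IsSymplecticFamily B (Fin.cons p f : Fin (m + 1) → V × V) ↔
      IsSymplecticFamily B f ∧
        (p.1 ∈ (pairingMap B f).ker ∧ p.2 ∈ (pairingMap B f).ker) ∧ B p.1 p.2 = 1 := by
  simp only [IsSymplecticFamily, Fin.forall_fin_succ, Fin.cons_zero, Fin.cons_succ,
    mem_ker_pairingMap, hB.self_eq_zero, Fin.succ_inj, Fin.succ_ne_zero, (Fin.succ_ne_zero _).symm,
    if_true, if_false, true_and, forall_and, hB.apply_eq_zero_comm (x := p.1),
    hB.apply_eq_zero_comm (x := p.2)]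
  tauto

theorem card_isSymplecticFamily_succ [Finite F] [Finite V] {B : V →ₗ[F] V →ₗ[F] F} (hB : B.IsAlt)
    (hB' : B.SeparatingLeft) {m w : ℕ} (hw : w * Nat.card F ^ (2 * m) = Nat.card V) :
    Nat.card {f : Fin (m + 1) → V × V // IsSymplecticFamily B f} * Nat.card F =
      Nat.card {f : Fin m → V × V // IsSymplecticFamily B f} * ((w - 1) * w) := by
  have := Fintype.ofFinite {f : Fin m → V × V // IsSymplecticFamily B f}
  let e : {f : Fin (m + 1) → V × V // IsSymplecticFamily B f} ≃
      Σ f : {f : Fin m → V × V // IsSymplecticFamily B f},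
        {p : (pairingMap B f.1).ker × (pairingMap B f.1).ker //
          (B.domRestrict₁₂ (pairingMap B f.1).ker (pairingMap B f.1).ker) p.1 p.2 = 1} :=
    { toFun f :=
        have h := (isSymplecticFamily_cons hB).1 ((Fin.cons_self_tail f.1).symm ▸ f.2)
        ⟨⟨Fin.tail f.1, h.1⟩, (⟨(f.1 0).1, h.2.1.1⟩, ⟨(f.1 0).2, h.2.1.2⟩), h.2.2⟩
      invFun s := ⟨Fin.cons (s.2.1.1, s.2.1.2) s.1,
        (isSymplecticFamily_cons hB).2 ⟨s.1.2, ⟨s.2.1.1.2, s.2.1.2.2⟩, s.2.2⟩⟩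
      left_inv f := Subtype.ext (Fin.cons_self_tail f.1)
      right_inv _ := rfl }
  rw [Nat.card_congr e, Nat.card_sigma, Finset.sum_mul,
    Finset.sum_congr rfl (g := fun _ ↦ (w - 1) * w),
    Finset.sum_const, Finset.card_univ, Nat.card_eq_fintype_card, smul_eq_mul]
  intro f _
  have hW : Nat.card (pairingMap B f.1).ker = w :=
    Nat.eq_of_mul_eq_mul_right (pow_pos Nat.card_pos _) ((f.2.card_ker_pairingMap hB).trans hw.symm)
  rw [card_hyperbolicPair_mul_card, hW]
  intro x hx
  by_contra hx0
  obtain ⟨y, hy, hxy⟩ :=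
    f.2.exists_mem_ker_pairingMap_apply_ne_zero hB hB' x.2 (by simpa using hx0)
  exact hxy (hx ⟨y, hy⟩)

theorem card_isSymplecticFamily [Finite F] [Finite V] {B : V →ₗ[F] V →ₗ[F] F} (hB : B.IsAlt)
    (hB' : B.SeparatingLeft) {l : ℕ} (hV : Nat.card V = Nat.card F ^ (2 * l)) {m : ℕ}
    (hm : m ≤ l) : Nat.card {f : Fin m → V × V // IsSymplecticFamily B f} =
      ∏ i ∈ Finset.range m, (Nat.card F ^ (2 * (l - 1 - i) + 2) - 1) *
        Nat.card F ^ (2 * (l - 1 - i) + 1) := by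
  induction m with
  | zero =>
    have : ∀ f : Fin 0 → V × V, IsSymplecticFamily B f := fun f i ↦ i.elim0
    simp [this]
  | succ m ih =>
    have hq : 0 < Nat.card F := Nat.card_pos
    have h := card_isSymplecticFamily_succ hB hB' (m := m)
      (w := Nat.card F ^ (2 * (l - 1 - m) + 2)) (by rw [hV, ← pow_add]; congr 1; omega)
    rw [ih (by omega)] at h
    rw [Finset.prod_range_succ]
    refine Nat.eq_of_mul_eq_mul_right hq (h.trans ?_)
    ring

end Counting

theorem card_symplecticGroup (F : Type*) [Field F] [Finite F] (l : ℕ) :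
    Nat.card (symplecticGroup (Fin l) F) =
      ∏ i ∈ Finset.range l, (Nat.card F ^ (2 * i + 2) - 1) * Nat.card F ^ (2 * i + 1) := by
  let B : (Fin l ⊕ Fin l → F) →ₗ[F] (Fin l ⊕ Fin l → F) →ₗ[F] F :=
    Matrix.toLinearMap₂' F (J (Fin l) F)
  have hBapply (x y : Fin l ⊕ Fin l → F) :
      B x y = ∑ i, (x (.inr i) * y (.inl i) - x (.inl i) * y (.inr i)) := by
    simp [B, Matrix.toLinearMap₂'_apply', J, dotProduct, fromBlocks_mulVec, neg_mulVec,
      Fintype.sum_sum_type, Finset.sum_sub_distrib]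
    ring
  have hB : B.IsAlt := fun x ↦ by simp [hBapply, mul_comm]
  have hB' : B.SeparatingLeft :=
    LinearMap.separatingLeft_toLinearMap₂'_of_det_ne_zero' (isUnit_det_J _ _).ne_zero
  have hV : Nat.card (Fin l ⊕ Fin l → F) = Nat.card F ^ (2 * l) := by
    simp [Nat.card_fun, two_mul]
  have hmem (A : Matrix (Fin l ⊕ Fin l) (Fin l ⊕ Fin l) F) : A ∈ symplecticGroup (Fin l) F ↔
      IsSymplecticFamily B fun i ↦ (A (.inr i), A (.inl i)) := by
    have hA (r s) : (A * J (Fin l) F * Aᵀ) r s = B (A r) (A s) := by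
      rw [Matrix.toLinearMap₂'_apply', Matrix.mul_assoc]
      rfl
    rw [SymplecticGroup.mem_iff, ← Matrix.ext_iff]
    simp only [hA, Sum.forall, IsSymplecticFamily]
    simp only [J, fromBlocks_apply₁₁, fromBlocks_apply₁₂, fromBlocks_apply₂₁, fromBlocks_apply₂₂,
      Matrix.zero_apply, Matrix.neg_apply, Matrix.one_apply]
    refine ⟨fun h i j ↦ ⟨(h.2 i).2 j, (h.1 i).1 j, (h.2 i).1 j⟩, fun h ↦ ⟨fun i ↦
      ⟨fun j ↦ (h i j).2.1, fun j ↦ ?_⟩, fun i ↦ ⟨fun j ↦ (h i j).2.2, fun j ↦ (h i j).1⟩⟩⟩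
    rw [← hB.neg, (h j i).2.2]
    simp only [eq_comm]
  let e : symplecticGroup (Fin l) F ≃
      {f : Fin l → (Fin l ⊕ Fin l → F) × (Fin l ⊕ Fin l → F) // IsSymplecticFamily B f} :=
    { toFun A := ⟨fun i ↦ (A.1 (.inr i), A.1 (.inl i)), (hmem _).1 A.2⟩
      invFun f := ⟨Matrix.of (Sum.elim (fun i ↦ (f.1 i).2) fun i ↦ (f.1 i).1), (hmem _).2 f.2⟩
      left_inv A := by ext (i | i) j <;> rfl
      right_inv f := rfl }
  rw [Nat.card_congr e, card_isSymplecticFamily hB hB' hV le_rfl,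
    Finset.prod_range_reflect (fun i ↦ (Nat.card F ^ (2 * i + 2) - 1) * Nat.card F ^ (2 * i + 1))]

theorem exists_eq_smul_one_of_mem_center_symplecticGroup {n R : Type*} [Fintype n] [DecidableEq n]
    [Nonempty n] [CommRing R] {A : symplecticGroup n R} (hA : A ∈ Subgroup.center _) :
    ∃ c : R, A.1 = c • 1 ∧ c ^ 2 = 1 := by
  obtain ⟨⟨M, hM⟩, rfl⟩ : ∃ M : symplecticGroup n R, M = A := ⟨A, rfl⟩
  obtain ⟨a, b, c, d, rfl⟩ : ∃ a b c d, M = fromBlocks a b c d :=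
    ⟨_, _, _, _, (fromBlocks_toBlocks M).symm⟩
  have hcomm {N : Matrix (n ⊕ n) (n ⊕ n) R} (hN : N ∈ symplecticGroup n R) :
      N * fromBlocks a b c d = fromBlocks a b c d * N :=
    congrArg Subtype.val (Subgroup.mem_center_iff.1 hA ⟨N, hN⟩)
  have hupper (X : Matrix n n R) (hX : Xᵀ = X) : X * c = 0 ∧ X * d = a * X := by
    have h := hcomm (N := fromBlocks 1 X 0 1) <| by simp [SymplecticGroup.fromBlocks_mem_iff, hX]
    simp only [fromBlocks_multiply, fromBlocks_inj] at h
    simpa [add_comm b] using And.intro h.1 h.2.1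
  have hlower : b = 0 := by
    have h := hcomm (N := fromBlocks 1 0 1 1) <| by simp [SymplecticGroup.fromBlocks_mem_iff]
    simp only [fromBlocks_multiply, fromBlocks_inj] at h
    simpa using h.1
  obtain ⟨rfl, rfl⟩ : c = 0 ∧ d = a := by simpa using hupper 1 transpose_one
  subst hlower
  have hdiag {i j : n} (hij : i ≠ j) : d i j = 0 := by
    have h := congrFun₂ (hupper (Matrix.single j j 1) (by simp)).2 i j
    simpa [hij] using h.symm
  have hscalar (i j : n) : d i i = d j j := by
    have h := congrFun₂ (hupper (Matrix.of fun _ _ ↦ 1) rfl).2 i j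
    simp only [Matrix.mul_apply, of_apply, one_mul, mul_one] at h
    rw [Finset.sum_eq_single_of_mem j (Finset.mem_univ _) fun k _ hk ↦ hdiag hk,
      Finset.sum_eq_single_of_mem i (Finset.mem_univ _) fun k _ hk ↦ hdiag hk.symm] at h
    exact h.symm
  let i := Classical.arbitrary n
  have hd : d = d i i • 1 := by
    ext j k
    obtain rfl | hjk := eq_or_ne j k
    · simp [hscalar i j]
    · simp [hdiag hjk, hjk]
  refine ⟨d i i, ?_, ?_⟩
  · rw [← fromBlocks_one, fromBlocks_smul, ← hd, smul_zero]
  · have h := (SymplecticGroup.fromBlocks_mem_iff.1 hM).2.2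
    rw [hd] at h
    simpa [sq] using congrFun₂ h i i

theorem card_center_symplecticGroup_le (n F : Type*) [Fintype n] [DecidableEq n] [Nonempty n]
    [Field F] [Finite F] :
    Nat.card (Subgroup.center (symplecticGroup n F)) ≤ Nat.gcd 2 (Nat.card F - 1) := by
  have : NeZero (Nat.gcd 2 (Nat.card F - 1)) := ⟨(Nat.gcd_pos_of_pos_left _ two_pos).ne'⟩
  choose c hc hc2 using fun A : Subgroup.center (symplecticGroup n F) ↦
    exists_eq_smul_one_of_mem_center_symplecticGroup A.2
  let u (A : Subgroup.center (symplecticGroup n F)) : Fˣ := Units.ofPowEqOne _ 2 (hc2 A) two_ne_zero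
  have hu (A) : u A ∈ rootsOfUnity (Nat.gcd 2 (Nat.card F - 1)) F := by
    rw [mem_rootsOfUnity]
    refine pow_gcd_eq_one.2 ⟨Units.pow_ofPowEqOne _ _, ?_⟩
    rw [← Nat.card_units]
    exact pow_card_eq_one'
  refine (Nat.card_le_card_of_injective (fun A ↦ (⟨u A, hu A⟩ : rootsOfUnity _ F))
    fun A A' h ↦ ?_).trans (card_rootsOfUnity F _)
  have hcc : c A = c A' := congrArg (fun x ↦ (x.1 : F)) h
  exact Subtype.ext (Subtype.ext (by rw [hc, hc, hcc]))

theorem prod_lt_pow {q l : ℕ} (hq : 2 ≤ q) (hl : l ≠ 0) :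
    ∏ i ∈ Finset.range l, (q ^ (2 * i + 2) - 1) * q ^ (2 * i + 1) < q ^ (l * (2 * l + 1)) := by
  have h : q ^ (l * (2 * l + 1)) = ∏ i ∈ Finset.range l, q ^ (2 * i + 2) * q ^ (2 * i + 1) := by
    clear hl
    induction l with
    | zero => simp
    | succ l ih => rw [Finset.prod_range_succ, ← ih]; ring
  rw [h]
  refine Finset.prod_lt_prod_of_nonempty (fun i _ ↦ ?_) (fun i _ ↦ ?_) (by simpa using hl)
  · have : 1 < q ^ (2 * i + 2) := Nat.one_lt_pow (by omega) hq
    exact Nat.mul_pos (by omega) (by positivity)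
  · have : 0 < q ^ (2 * i + 2) := by positivity
    gcongr
    omega

theorem pow_lt_two_mul_prod {q : ℕ} (hq : 2 ≤ q) (l : ℕ) :
    q ^ (l * (2 * l + 1)) <
      2 * ∏ i ∈ Finset.range l, (q ^ (2 * i + 2) - 1) * q ^ (2 * i + 1) := by
  have hq' : (2 : ℝ) ≤ q := by exact_mod_cast hq
  have hx : ((q : ℝ) ^ 2)⁻¹ ≤ 1 / 4 := by
    rw [one_div]; gcongr; nlinarith
  have hx0 : 0 < ((q : ℝ) ^ 2)⁻¹ := by positivity
  have key : (q : ℝ) ^ (l * (2 * l + 1)) * (1 + ((q : ℝ) ^ 2)⁻¹ ^ l) ≤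
      2 * ∏ i ∈ Finset.range l, ((q : ℝ) ^ (2 * i + 2) - 1) * q ^ (2 * i + 1) := by
    induction l with
    | zero => norm_num
    | succ l ih =>
      rw [Finset.prod_range_succ]
      have h1 : ((q : ℝ) ^ (2 * l + 2) - 1) * q ^ (2 * l + 1) =
          (1 - ((q : ℝ) ^ 2)⁻¹ ^ (l + 1)) * q ^ (4 * l + 3) := by
        have h : (q : ℝ) ^ (2 * l + 2) * ((q : ℝ) ^ 2)⁻¹ ^ (l + 1) = 1 := by
          rw [show 2 * l + 2 = 2 * (l + 1) by ring, pow_mul, ← mul_pow,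
            mul_inv_cancel₀ (by positivity), one_pow]
        linear_combination (q : ℝ) ^ (2 * l + 1) * h
      set x := ((q : ℝ) ^ 2)⁻¹
      have hxl : x ^ l ≤ 1 := pow_le_one₀ hx0.le (by linarith)
      have hxl0 : 0 < x ^ l := by positivity
      rw [← mul_assoc, h1]
      calc (q : ℝ) ^ ((l + 1) * (2 * (l + 1) + 1)) * (1 + x ^ (l + 1))
          = (q : ℝ) ^ (l * (2 * l + 1)) * (1 + x ^ (l + 1)) * q ^ (4 * l + 3) := by ring
        _ ≤ (q : ℝ) ^ (l * (2 * l + 1)) * ((1 + x ^ l) * (1 - x ^ (l + 1))) * q ^ (4 * l + 3) := by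
          gcongr
          rw [pow_succ]
          nlinarith [mul_pos hxl0 hx0, mul_nonneg hxl0.le (sub_nonneg.2 hx),
            mul_nonneg (mul_pos hxl0 hx0).le (sub_nonneg.2 hxl)]
        _ = (q : ℝ) ^ (l * (2 * l + 1)) * (1 + x ^ l) * ((1 - x ^ (l + 1)) * q ^ (4 * l + 3)) := by
          ring
        _ ≤ _ := by
          refine mul_le_mul_of_nonneg_right ih (mul_nonneg ?_ (by positivity))
          rw [pow_succ]
          nlinarith
  have hlt : (q : ℝ) ^ (l * (2 * l + 1)) <
      2 * ∏ i ∈ Finset.range l, ((q : ℝ) ^ (2 * i + 2) - 1) * q ^ (2 * i + 1) := by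
    refine lt_of_lt_of_le ?_ key
    have : 0 < (q : ℝ) ^ (l * (2 * l + 1)) := by positivity
    nlinarith [pow_pos hx0 l]
  have hcast : ((2 * ∏ i ∈ Finset.range l, (q ^ (2 * i + 2) - 1) * q ^ (2 * i + 1) : ℕ) : ℝ) =
      2 * ∏ i ∈ Finset.range l, ((q : ℝ) ^ (2 * i + 2) - 1) * q ^ (2 * i + 1) := by
    push_cast [Nat.cast_sub (Nat.one_le_pow _ q (by omega))]
    rfl
  rw [← hcast] at hlt
  exact_mod_cast hlt


/-- If `F` is a finite field with `|F| = q`, `l ≥ 2`, `n = 2l` and `α = gcd(2, q−1)`, then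
`(1/(2α))·q^{n(n+1)/2} < |PSp_n(F)| < q^{n(n+1)/2}`. -/
theorem stmt_6 (F : Type*) [Field F] [Fintype F] (q l : ℕ)
    (hq : Fintype.card F = q) (hl : 2 ≤ l) :
    (1 / (2 * (Nat.gcd 2 (q - 1) : ℝ))) * (q : ℝ) ^ ((2 * l) * (2 * l + 1) / 2) <
      Nat.card (Matrix.symplecticGroup (Fin l) F ⧸
        Subgroup.center (Matrix.symplecticGroup (Fin l) F)) ∧
    (Nat.card (Matrix.symplecticGroup (Fin l) F ⧸
        Subgroup.center (Matrix.symplecticGroup (Fin l) F)) : ℝ) <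
      (q : ℝ) ^ ((2 * l) * (2 * l + 1) / 2) := by
  have hq2 : 2 ≤ q := hq ▸ Fintype.one_lt_card
  have : NeZero l := ⟨by omega⟩
  have hexp : 2 * l * (2 * l + 1) / 2 = l * (2 * l + 1) := by
    rw [mul_assoc, Nat.mul_div_cancel_left _ two_pos]
  have hcard := Subgroup.card_eq_card_quotient_mul_card_subgroup
    (Subgroup.center (symplecticGroup (Fin l) F))
  have hZ := card_center_symplecticGroup_le (Fin l) F
  have hZ0 : 0 < Nat.card (Subgroup.center (symplecticGroup (Fin l) F)) := Nat.card_pos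
  rw [card_symplecticGroup] at hcard
  rw [Nat.card_eq_fintype_card (α := F), hq] at hcard hZ
  have hupper := prod_lt_pow hq2 (l := l) (by omega)
  have hlower := pow_lt_two_mul_prod hq2 l
  rw [hcard] at hupper hlower
  rw [hexp]
  have hg : 0 < Nat.gcd 2 (q - 1) := Nat.gcd_pos_of_pos_left _ two_pos
  constructor
  · rw [one_div, inv_mul_lt_iff₀ (by positivity)]
    norm_cast
    refine hlower.trans_le ?_
    rw [mul_assoc, mul_comm (Nat.gcd _ _)]
    gcongr
  · norm_cast
    exact (Nat.le_mul_of_pos_right _ hZ0).trans_lt hupper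
end

section
/- Let n ≥ 5 and let k be an integer with 1 ≤ k < n/2. Let s be a subset of {1,…,n} of size k, and let H be the stabilizer of s in the alternating group A_n (that is, the subgroup of all even permutations g with g(s) = s). Then |H|³ ≥ |A_n|; that is, H is a large subgroup of A_n. -/
open Pointwise

theorem four_mul_two_pow_le_factorial_sq {a : ℕ} (ha : 3 ≤ a) :
    4 * 2 ^ a ≤ a.factorial ^ 2 := by
  induction a, ha using Nat.le_induction with
  | base => decide
  | succ a ha ih =>
    rw [Nat.factorial_succ, mul_pow, pow_succ]
    nlinarith [Nat.mul_le_mul (show 2 ≤ (a + 1) ^ 2 by nlinarith) ih]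

theorem two_pow_le_factorial_sq {b : ℕ} (hb : 2 ≤ b) : 2 ^ b ≤ b.factorial ^ 2 := by
  rcases hb.eq_or_lt with rfl | h
  · decide
  · linarith [four_mul_two_pow_le_factorial_sq h, Nat.zero_le (2 ^ b)]

theorem four_mul_choose_le_factorial_mul_factorial_sq {a b : ℕ} (ha : 3 ≤ a) (hb : 1 ≤ b) :
    4 * (a + b).choose b ≤ (b.factorial * a.factorial) ^ 2 := by
  have h := four_mul_two_pow_le_factorial_sq ha
  rcases hb.eq_or_lt with rfl | hb
  · have : a < 2 ^ a := Nat.lt_two_pow_self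
    simp only [Nat.choose_one_right, Nat.factorial_one, one_mul]
    linarith
  · calc 4 * (a + b).choose b ≤ 4 * 2 ^ (a + b) := by gcongr; exact Nat.choose_le_two_pow _ _
      _ = 2 ^ b * (4 * 2 ^ a) := by ring
      _ ≤ b.factorial ^ 2 * a.factorial ^ 2 :=
        Nat.mul_le_mul (two_pow_le_factorial_sq hb) h
      _ = _ := (mul_pow _ _ _).symm

/-- Orbit-stabilizer bound for a group acting on the subsets of its permuted set. -/
theorem card_le_choose_mul_card_stabilizer {α G : Type*} [Fintype α] [DecidableEq α] [Group G]
    [MulAction G α] (s : Finset α) :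
    Nat.card G ≤
      (Fintype.card α).choose s.card * Nat.card (MulAction.stabilizer G s) := by
  rw [← (MulAction.stabilizer G s).index_mul_card, MulAction.index_stabilizer,
    ← Finset.card_univ, ← Finset.card_powersetCard, ← Set.ncard_coe_finset]
  gcongr
  · exact Finset.finite_toSet _
  · rintro _ ⟨g, rfl⟩
    simp [Finset.mem_powersetCard]

/-- For `n ≥ 5` and `1 ≤ k < n/2`, the stabilizer in the alternating group `A_n`
of a `k`-element subset `s` of `{1,…,n}` is a large subgroup of `A_n`. -/
theorem stmt_9 (n k : ℕ) (hn : 5 ≤ n) (hk : 1 ≤ k) (hkn : 2 * k < n)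
    (s : Finset (Fin n)) (hs : s.card = k) :
    Nat.card (alternatingGroup (Fin n)) ≤
      Nat.card (MulAction.stabilizer (alternatingGroup (Fin n)) s) ^ 3 := by
  have : Nontrivial (Fin n) := Fin.nontrivial_iff_two_le.mpr (by omega)
  have horb := card_le_choose_mul_card_stabilizer (G := alternatingGroup (Fin n)) s
  have hcard := two_mul_nat_card_alternatingGroup (α := Fin n)
  rw [Nat.card_perm, Nat.card_fin, ← Nat.choose_mul_factorial_mul_factorial
    (show k ≤ n by omega)] at hcard
  have hchoose := four_mul_choose_le_factorial_mul_factorial_sq (a := n - k) (by omega) hk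
  rw [Nat.sub_add_cancel (by omega)] at hchoose
  rw [Fintype.card_fin, hs] at horb
  generalize Nat.card (MulAction.stabilizer (alternatingGroup (Fin n)) s) = h at *
  have hpos : 0 < n.choose k := Nat.choose_pos (by omega)
  have hle : k.factorial * (n - k).factorial ≤ 2 * h := by
    refine Nat.le_of_mul_le_mul_left ?_ hpos
    linarith
  have hsq : n.choose k ≤ h ^ 2 := by
    have := Nat.pow_le_pow_left hle 2
    linarith
  calc _ ≤ n.choose k * h := horb
    _ ≤ h ^ 2 * h := by gcongr
    _ = h ^ 3 := by ring
end

section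
/- For every integer a ≥ 5, one has 2·(a!)³ < (a(a−1)/2)! ; that is, (a!)³ < (1/2)·C(a,2)! where C(a,2) = a(a−1)/2 is the binomial coefficient. -/
/-- For every integer `a ≥ 5`, `2·(a!)³ < (a(a−1)/2)!`. -/
theorem stmt_11 (a : ℕ) (ha : 5 ≤ a) :
    2 * (Nat.factorial a) ^ 3 < Nat.factorial (a * (a - 1) / 2) := by
  rw [← Nat.choose_two_right]
  induction a, ha using Nat.le_induction with
  | base => norm_num [Nat.factorial, Nat.choose]
  | succ a ha ih =>
    have hchoose : (a + 1).choose 2 = a.choose 2 + a := by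
      rw [Nat.choose_succ_succ' a 1, Nat.choose_one_right, add_comm]
    have hle : a ≤ a.choose 2 := by
      rw [Nat.choose_two_right, Nat.le_div_iff_mul_le two_pos]
      exact Nat.mul_le_mul_left a (by lia)
    rw [hchoose]
    calc 2 * (a + 1).factorial ^ 3
        = 2 * a.factorial ^ 3 * (a + 1) ^ 3 := by rw [Nat.factorial_succ]; ring
      _ < (a.choose 2).factorial * (a + 1) ^ 3 := by gcongr
      _ ≤ (a.choose 2).factorial * (a.choose 2 + 1) ^ a := by
        refine Nat.mul_le_mul_left _ ?_
        calc (a + 1) ^ 3 ≤ (a + 1) ^ a := Nat.pow_le_pow_right (by lia) (by lia)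
          _ ≤ (a.choose 2 + 1) ^ a := by gcongr
      _ ≤ (a.choose 2 + a).factorial := Nat.factorial_mul_pow_le_factorial
end

section
/- Let F be a finite field, let n ≥ 2, let V = Fⁿ be the standard n-dimensional F-vector space, and let W be an F-subspace of V with 0 < dim W < n. Let H be the stabilizer of W under the natural action of GL_n(F) on subspaces of V (that is, H = {g ∈ GL_n(F) : g·W = W}). Then |H|³ ≥ |GL_n(F)|; that is, the maximal parabolic subgroups of GL_n(F) are large. -/
open Pointwise

theorem prod_pow_sub_pow_le (q k m : ℕ) (hq : 2 ≤ q) (hm : 0 < m) :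
    ∏ i : Fin (k + m), (q ^ (k + m) - q ^ (i : ℕ)) ≤
      q ^ (3 * (k * m)) * (∏ i : Fin k, (q ^ k - q ^ (i : ℕ))) *
        ∏ i : Fin m, (q ^ m - q ^ (i : ℕ)) := by
  rw [Fin.prod_univ_add]
  have hfirst : ∏ i : Fin k, (q ^ (k + m) - q ^ (i : ℕ)) ≤
      ∏ i : Fin k, (q ^ (2 * m) * (q ^ k - q ^ (i : ℕ))) := by
    refine Finset.prod_le_prod' fun i _ ↦ ?_
    have hij : (i : ℕ) + (k - i) = k := by omega
    have ha : 2 ≤ q ^ m := hq.trans (Nat.le_self_pow hm.ne' q)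
    have hb : 2 ≤ q ^ (k - (i : ℕ)) := hq.trans (Nat.le_self_pow (by omega) q)
    have hk : q ^ k = q ^ (i : ℕ) * q ^ (k - (i : ℕ)) := by rw [← pow_add, hij]
    rw [pow_add, hk, mul_comm 2 m, pow_mul]
    generalize q ^ (i : ℕ) = c, q ^ m = a, q ^ (k - (i : ℕ)) = b at *
    obtain ⟨a, rfl⟩ := Nat.exists_eq_add_of_le ha
    obtain ⟨b, rfl⟩ := Nat.exists_eq_add_of_le hb
    have hsub : c * (2 + b) - c = c * (1 + b) := by
      rw [Nat.sub_eq_iff_eq_add (by nlinarith)]; ring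
    rw [hsub, Nat.sub_le_iff_le_add]
    have : (2 + b) * (2 + a) ≤ (2 + a) ^ 2 * (1 + b) + 1 := by
      nlinarith [Nat.zero_le (a * b), Nat.zero_le (a * a * b)]
    nlinarith
  have hsecond : ∏ i : Fin m, (q ^ (k + m) - q ^ (k + (i : ℕ))) =
      ∏ i : Fin m, (q ^ k * (q ^ m - q ^ (i : ℕ))) := by
    simp only [pow_add, Nat.mul_sub]
  simp only [Fin.val_castAdd, Fin.val_natAdd]
  rw [hsecond]
  refine (Nat.mul_le_mul_right _ hfirst).trans_eq ?_
  simp only [Finset.prod_mul_distrib, Finset.prod_const, Finset.card_univ, Fintype.card_fin]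
  ring

section

variable {F V : Type*} [Field F] [AddCommGroup V] [Module F V]

/-- The automorphism of `V = U ⊕ W` given by the block triangular matrix with diagonal
blocks `d`, `a` and off-diagonal block `c`. -/
noncomputable def blockTriangular {U W : Submodule F V} (h : IsCompl U W)
    (x : (U ≃ₗ[F] U) × (W ≃ₗ[F] W) × (U →ₗ[F] W)) : V ≃ₗ[F] V :=
  (U.prodEquivOfIsCompl W h).symm ≪≫ₗ x.1.skewProd x.2.1 x.2.2 ≪≫ₗ U.prodEquivOfIsCompl W h

theorem blockTriangular_injective {U W : Submodule F V} (h : IsCompl U W) :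
    Function.Injective (blockTriangular h) := by
  rintro ⟨d, a, c⟩ ⟨d', a', c'⟩ hx
  have key (u : U) (w : W) : (d u, a w + c u) = (d' u, a' w + c' u) := by
    have := LinearEquiv.congr_fun hx (U.prodEquivOfIsCompl W h (u, w))
    simpa only [blockTriangular, LinearEquiv.trans_apply, LinearEquiv.symm_apply_apply,
      LinearEquiv.skewProd_apply, EmbeddingLike.apply_eq_iff_eq] using this
  refine Prod.ext (LinearEquiv.ext fun u ↦ ?_)
    (Prod.ext (LinearEquiv.ext fun w ↦ ?_) (LinearMap.ext fun u ↦ ?_))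
  · exact congrArg Prod.fst (key u 0)
  · simpa using congrArg Prod.snd (key 0 w)
  · simpa using congrArg Prod.snd (key u 0)

theorem blockTriangular_apply_mem {U W : Submodule F V} (h : IsCompl U W)
    (x : (U ≃ₗ[F] U) × (W ≃ₗ[F] W) × (U →ₗ[F] W)) {w : V} (hw : w ∈ W) :
    blockTriangular h x w ∈ W := by
  have : w = U.prodEquivOfIsCompl W h (0, ⟨w, hw⟩) := by simp
  rw [this, blockTriangular, LinearEquiv.trans_apply, LinearEquiv.trans_apply,
    LinearEquiv.symm_apply_apply]
  simp

theorem mem_stabilizer_of_forall_mem [FiniteDimensional F V] {W : Submodule F V}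
    (g : LinearMap.GeneralLinearGroup F V) (hg : ∀ w ∈ W, (g : V →ₗ[F] V) w ∈ W) :
    g ∈ MulAction.stabilizer (LinearMap.GeneralLinearGroup F V) W := by
  rw [MulAction.mem_stabilizer_iff]
  have hle : g • W ≤ W := by
    rintro _ ⟨w, hw, rfl⟩
    exact hg w hw
  refine Submodule.eq_of_le_of_finrank_eq hle ?_
  exact (LinearMap.GeneralLinearGroup.generalLinearEquiv F V g).finrank_map_eq W

theorem card_linearEquiv [Fintype F] [FiniteDimensional F V] :
    Nat.card (V ≃ₗ[F] V) =
      ∏ i : Fin (Module.finrank F V),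
        (Fintype.card F ^ Module.finrank F V - Fintype.card F ^ (i : ℕ)) := by
  rw [← Matrix.card_GL_field]
  refine Nat.card_congr ?_
  refine (LinearMap.GeneralLinearGroup.generalLinearEquiv F V).symm.toEquiv.trans ?_
  exact (Units.mapEquiv (LinearMap.toMatrixAlgEquiv (Module.finBasis F V)).toMulEquiv).toEquiv

theorem card_block_data_le_card_stabilizer [Finite F] [FiniteDimensional F V]
    {U W : Submodule F V} (h : IsCompl U W) :
    Nat.card (U ≃ₗ[F] U) * (Nat.card (W ≃ₗ[F] W) * Nat.card (U →ₗ[F] W)) ≤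
      Nat.card (MulAction.stabilizer (LinearMap.GeneralLinearGroup F V) W) := by
  have : Finite (V →ₗ[F] V) := Module.finite_of_finite F
  have : Finite (LinearMap.GeneralLinearGroup F V) := inferInstanceAs (Finite (V →ₗ[F] V)ˣ)
  rw [← Nat.card_prod, ← Nat.card_prod]
  let e := (LinearMap.GeneralLinearGroup.generalLinearEquiv F V).symm
  refine Nat.card_le_card_of_injective
    (fun x ↦ ⟨e (blockTriangular h x), mem_stabilizer_of_forall_mem _ fun w hw ↦
      blockTriangular_apply_mem h x hw⟩) fun x y hxy ↦ ?_
  exact blockTriangular_injective h (e.injective (congrArg Subtype.val hxy))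

end

/-- Let `F` be a finite field, `n ≥ 2`, and `W` an `F`-subspace of `Fⁿ` with
`0 < dim W < n`. Then the stabilizer `H = {g ∈ GL_n(F) : g·W = W}` of `W` in
`GL_n(F)` satisfies `|H|³ ≥ |GL_n(F)|`: maximal parabolic subgroups are large. -/
theorem stmt_15 (F : Type*) [Field F] [Fintype F] (n : ℕ) (hn : 2 ≤ n)
    (W : Submodule F (Fin n → F))
    (h1 : 0 < Module.finrank F W) (h2 : Module.finrank F W < n) :
    Nat.card (GL (Fin n) F) ≤
      Nat.card (Subgroup.comap (Matrix.GeneralLinearGroup.toLin.toMonoidHom :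
          GL (Fin n) F →* LinearMap.GeneralLinearGroup F (Fin n → F))
        (MulAction.stabilizer (LinearMap.GeneralLinearGroup F (Fin n → F)) W)) ^ 3 := by
  let q := Fintype.card F
  obtain ⟨U, hWU⟩ := W.exists_isCompl
  have h := hWU.symm
  set k := Module.finrank F W
  set m := Module.finrank F U
  have hsum : k + m = n := by
    simpa using Submodule.finrank_add_eq_of_isCompl hWU
  have hhom : Nat.card (U →ₗ[F] W) = q ^ (k * m) := by
    rw [Module.natCard_eq_pow_finrank (K := F), Module.finrank_linearMap, Nat.card_eq_fintype_card,
      mul_comm]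
  have hcomap : Nat.card (Subgroup.comap (Matrix.GeneralLinearGroup.toLin.toMonoidHom :
      GL (Fin n) F →* LinearMap.GeneralLinearGroup F (Fin n → F))
      (MulAction.stabilizer (LinearMap.GeneralLinearGroup F (Fin n → F)) W)) =
      Nat.card (MulAction.stabilizer (LinearMap.GeneralLinearGroup F (Fin n → F)) W) :=
    Nat.card_congr (Matrix.GeneralLinearGroup.toLin.toEquiv.subtypeEquiv fun _ ↦ Iff.rfl)
  have hle := card_block_data_le_card_stabilizer h
  rw [hcomap]
  refine le_trans ?_ (Nat.pow_le_pow_left hle 3)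
  have hprod := prod_pow_sub_pow_le q k m Fintype.one_lt_card (by omega)
  rw [← card_linearEquiv (V := W), ← card_linearEquiv (V := U), hsum,
    ← Matrix.card_GL_field] at hprod
  rw [hhom]
  refine hprod.trans ?_
  calc q ^ (3 * (k * m)) * Nat.card (W ≃ₗ[F] W) * Nat.card (U ≃ₗ[F] U)
      ≤ q ^ (3 * (k * m)) * Nat.card (W ≃ₗ[F] W) ^ 3 * Nat.card (U ≃ₗ[F] U) ^ 3 := by
        gcongr <;> exact Nat.le_self_pow three_ne_zero _
    _ = (Nat.card (U ≃ₗ[F] U) * (Nat.card (W ≃ₗ[F] W) * q ^ (k * m))) ^ 3 := by ring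
end

section
/- Let F be a finite field and let l ≥ 2 be an integer. Then |Sp_{2l}(F)|³ ≥ |GL_{2l}(F)|; that is, the symplectic group Sp_{2l}(F), viewed as a subgroup of GL_{2l}(F), is a large subgroup. -/
open Matrix in
/-- The element of the big cell of the symplectic group attached to two symmetric matrices, given
as functions on unordered pairs, and to an invertible matrix. -/
noncomputable def symplecticBigCell {n F : Type*} [Fintype n] [DecidableEq n] [Field F]
    (x : (Sym2 n → F) × (Sym2 n → F) × GL n F) : symplecticGroup n F :=
  let S : Matrix n n F := of fun i j => x.1 s(i, j)
  let T : Matrix n n F := of fun i j => x.2.1 s(i, j)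
  ⟨fromBlocks 1 0 S 1 *
      fromBlocks (x.2.2 : Matrix n n F) 0 0 (x.2.2 : Matrix n n F)⁻¹ᵀ *
      fromBlocks 1 T 0 1, by
    have hS : Sᵀ = S := by ext i j; simp [S, Sym2.eq_swap]
    have hT : Tᵀ = T := by ext i j; simp [T, Sym2.eq_swap]
    have hg : (x.2.2 : Matrix n n F)⁻¹ᵀ * (x.2.2 : Matrix n n F)ᵀ = 1 := by
      rw [← transpose_mul, ← coe_units_inv, Units.mul_inv, transpose_one]
    refine mul_mem (mul_mem ?_ ?_) ?_ <;>
      simp only [SymplecticGroup.mem_iff, J, fromBlocks_transpose, fromBlocks_multiply] <;>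
      simp [hS, hT, hg]⟩

open Matrix in
theorem symplecticBigCell_injective {n F : Type*} [Fintype n] [DecidableEq n] [Field F] :
    Function.Injective (symplecticBigCell (n := n) (F := F)) := by
  rintro ⟨s, t, g⟩ ⟨s', t', g'⟩ h
  have h := congrArg Subtype.val h
  simp only [symplecticBigCell, fromBlocks_multiply, fromBlocks_inj, Matrix.one_mul,
    Matrix.mul_one, Matrix.mul_zero, Matrix.zero_mul, add_zero, zero_add] at h
  obtain ⟨hg, hT, hS, -⟩ := h
  obtain rfl : g = g' := Units.ext hg
  have hs := (Units.mul_left_inj g).1 hS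
  have ht := (Units.mul_right_inj g).1 hT
  have ext_sym2 : ∀ {a b : Sym2 n → F},
      (of fun i j => a s(i, j)) = (of fun i j => b s(i, j)) → a = b := by
    intro a b hab
    funext z
    induction z with
    | _ i j => exact congrFun (congrFun hab i) j
  rw [ext_sym2 hs, ext_sym2 ht]

theorem pow_choose_two_le_card_GL (F : Type*) [Field F] [Fintype F] (l : ℕ) :
    Fintype.card F ^ l.choose 2 ≤ Nat.card (GL (Fin l) F) := by
  rw [Matrix.card_GL_field, Nat.choose_two_right, ← Finset.sum_range_id,
    ← Finset.prod_pow_eq_pow_sum, ← Fin.prod_univ_eq_prod_range (fun i => Fintype.card F ^ i)]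
  refine Finset.prod_le_prod' fun i _ => Nat.le_sub_of_add_le ?_
  calc Fintype.card F ^ (i : ℕ) + Fintype.card F ^ (i : ℕ)
      = 2 * Fintype.card F ^ (i : ℕ) := (two_mul _).symm
    _ ≤ Fintype.card F * Fintype.card F ^ (i : ℕ) :=
        Nat.mul_le_mul_right _ Fintype.one_lt_card
    _ = Fintype.card F ^ ((i : ℕ) + 1) := (pow_succ' _ _).symm
    _ ≤ Fintype.card F ^ l := Nat.pow_le_pow_right Fintype.card_pos i.isLt

theorem pow_le_card_symplecticGroup (F : Type*) [Field F] [Fintype F] (l : ℕ) :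
    Fintype.card F ^ (2 * (l + 1).choose 2 + l.choose 2) ≤
      Nat.card (Matrix.symplecticGroup (Fin l) F) := by
  refine le_trans ?_ (Nat.card_le_card_of_injective _ symplecticBigCell_injective)
  rw [Nat.card_prod, Nat.card_prod, Nat.card_eq_fintype_card, Fintype.card_fun, Sym2.card,
    Fintype.card_fin, pow_add, two_mul, pow_add, mul_assoc]
  gcongr
  exact pow_choose_two_le_card_GL F l

theorem card_GL_le_pow (n F : Type*) [Fintype n] [DecidableEq n] [Field F] [Fintype F] :
    Nat.card (GL n F) ≤ Fintype.card F ^ (Fintype.card n * Fintype.card n) := by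
  refine (Nat.card_le_card_of_injective (β := Matrix n n F) _ Units.val_injective).trans ?_
  rw [Matrix, Nat.card_fun, Nat.card_fun, ← pow_mul, Nat.card_eq_fintype_card,
    Nat.card_eq_fintype_card]

/-- For a finite field `F` and `l ≥ 2`, `|Sp_{2l}(F)|³ ≥ |GL_{2l}(F)|`: the
symplectic group is a large subgroup of the general linear group. -/
theorem stmt_16 (F : Type*) [Field F] [Fintype F] (l : ℕ) (hl : 2 ≤ l) :
    Nat.card (GL (Fin l ⊕ Fin l) F) ≤
      Nat.card (Matrix.symplecticGroup (Fin l) F) ^ 3 := by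
  refine (card_GL_le_pow _ F).trans <|
    le_trans ?_ (Nat.pow_le_pow_left (pow_le_card_symplecticGroup F l) 3)
  rw [← pow_mul]
  refine Nat.pow_le_pow_right Fintype.card_pos ?_
  rw [Fintype.card_sum, Fintype.card_fin]
  have h₁ : (l + 1).choose 2 = l + l.choose 2 := by simp [Nat.choose_succ_succ']
  have h₂ : l.choose 2 * 2 + l = l * l := by
    cases l with
    | zero => rfl
    | succ k =>
      rw [Nat.choose_two_right, Nat.div_two_mul_two_of_even (Nat.even_mul_pred_self _),
        Nat.add_sub_cancel]
      ring
  nlinarith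
end

section
/- Let F be a finite field and let n ≥ 2 be an even integer. Then (2·|GL_{n/2}(F)|²)³ ≥ |GL_n(F)|. Equivalently, the imprimitive subgroup GL_{n/2}(F) ≀ S₂ of GL_n(F), of order 2·|GL_{n/2}(F)|², stabilizing a direct sum decomposition Fⁿ = V₁ ⊕ V₂ with dim V₁ = dim V₂ = n/2, is a large subgroup of GL_n(F). -/
/-- The order polynomial of `GL_m` satisfies a two-term recursion in `m`. -/
theorem prod_pow_sub_pow_succ (q m : ℕ) :
    ∏ i : Fin (m + 1), (q ^ (m + 1) - q ^ (i : ℕ)) =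
      q ^ m * (q ^ (m + 1) - 1) * ∏ i : Fin m, (q ^ m - q ^ (i : ℕ)) := by
  have h (i : Fin m) : q ^ (m + 1) - q ^ (i.succ : ℕ) = q * (q ^ m - q ^ (i : ℕ)) := by
    rw [Fin.val_succ, pow_succ', pow_succ', Nat.mul_sub]
  simp only [Fin.prod_univ_succ, h, Finset.prod_mul_distrib, Finset.prod_const, Finset.card_univ,
    Fintype.card_fin, Fin.val_zero, pow_zero]
  ring

theorem mul_sub_one_mul_le_pow_six {q a : ℕ} (hq : 2 ≤ q) (ha : 2 ≤ a) :
    q * a ^ 2 * (q ^ 2 * a ^ 2 - 1) * (a ^ 2 * (q * a ^ 2 - 1)) ≤ (a * (q * a - 1)) ^ 6 := by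
  have h4 : 4 ≤ q * a := Nat.mul_le_mul hq ha
  obtain ⟨y, hy⟩ : ∃ y, q * a = y + 1 := ⟨q * a - 1, by omega⟩
  have hcube : (q * a) ^ 2 ≤ y ^ 3 := by
    rw [hy]
    nlinarith [sq_nonneg y, Nat.mul_le_mul_right (y ^ 2) (show 3 ≤ y by omega)]
  calc q * a ^ 2 * (q ^ 2 * a ^ 2 - 1) * (a ^ 2 * (q * a ^ 2 - 1))
      ≤ q * a ^ 2 * (q ^ 2 * a ^ 2) * (a ^ 2 * (q * a ^ 2)) := by
        gcongr <;> exact Nat.sub_le _ _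
    _ = a ^ 4 * ((q * a) ^ 2) ^ 2 := by ring
    _ ≤ a ^ 6 * (y ^ 3) ^ 2 := by
        gcongr
        · omega
        · norm_num
    _ = (a * (q * a - 1)) ^ 6 := by
        rw [hy, Nat.add_sub_cancel]
        ring

/-- The order of `GL_{2m}` is at most eight times the sixth power of the order of `GL_m`. -/
theorem prod_pow_sub_pow_two_mul_le {q m : ℕ} (hq : 2 ≤ q) (hm : 1 ≤ m) :
    ∏ i : Fin (2 * m), (q ^ (2 * m) - q ^ (i : ℕ)) ≤
      8 * (∏ i : Fin m, (q ^ m - q ^ (i : ℕ))) ^ 6 := by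
  induction m, hm using Nat.le_induction with
  | base =>
    obtain ⟨p, rfl⟩ : ∃ p, q = p + 2 := ⟨q - 2, by omega⟩
    have h₁ : (p + 2) ^ 2 - 1 = (p + 1) * (p + 3) := by
      rw [Nat.sub_eq_iff_eq_add (Nat.one_le_pow _ _ (by omega))]
      ring
    have h₂ : (p + 2) ^ 2 - (p + 2) = (p + 1) * (p + 2) := by
      rw [Nat.sub_eq_iff_eq_add (Nat.le_self_pow (by norm_num) _)]
      ring
    change ∏ i : Fin 2, ((p + 2) ^ 2 - (p + 2) ^ (i : ℕ)) ≤ _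
    simp only [Fin.prod_univ_two, Fin.prod_univ_one, Fin.val_zero, Fin.val_one, pow_zero,
      pow_one, h₁, h₂, show p + 2 - 1 = p + 1 by omega]
    calc (p + 1) * (p + 3) * ((p + 1) * (p + 2)) = (p + 1) ^ 2 * ((p + 3) * (p + 2)) := by ring
      _ ≤ (p + 1) ^ 2 * (8 * (p + 1) ^ 4) :=
        Nat.mul_le_mul_left _ (by
          nlinarith [Nat.zero_le (p ^ 4), Nat.zero_le (p ^ 3), Nat.zero_le (p ^ 2)])
      _ = 8 * (p + 1) ^ 6 := by ring
  | succ m hm ih =>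
    have ha : 2 ≤ q ^ m := hq.trans (Nat.le_self_pow (by omega) q)
    rw [show 2 * (m + 1) = 2 * m + 1 + 1 by ring, prod_pow_sub_pow_succ, prod_pow_sub_pow_succ,
      prod_pow_sub_pow_succ q m]
    calc _ = q * (q ^ m) ^ 2 * (q ^ 2 * (q ^ m) ^ 2 - 1) *
          ((q ^ m) ^ 2 * (q * (q ^ m) ^ 2 - 1)) *
            ∏ i : Fin (2 * m), (q ^ (2 * m) - q ^ (i : ℕ)) := by ring_nf
      _ ≤ (q ^ m * (q * q ^ m - 1)) ^ 6 * (8 * (∏ i : Fin m, (q ^ m - q ^ (i : ℕ))) ^ 6) :=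
        Nat.mul_le_mul (mul_sub_one_mul_le_pow_six hq ha) ih
      _ = _ := by
        rw [pow_succ' q m]
        ring

/-- For a finite field `F` and even `n ≥ 2`, `(2·|GL_{n/2}(F)|²)³ ≥ |GL_n(F)|`:
the imprimitive subgroup `GL_{n/2}(F) ≀ S₂` is a large subgroup of `GL_n(F)`. -/
theorem stmt_17 (F : Type*) [Field F] [Fintype F] (n : ℕ) (hn : 2 ≤ n) (heven : Even n) :
    Nat.card (GL (Fin n) F) ≤
      (2 * Nat.card (GL (Fin (n / 2)) F) ^ 2) ^ 3 := by
  obtain ⟨m, rfl⟩ := heven.two_dvd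
  rw [Nat.mul_div_cancel_left m two_pos, Matrix.card_GL_field, Matrix.card_GL_field]
  refine (prod_pow_sub_pow_two_mul_le Fintype.one_lt_card (by omega)).trans_eq ?_
  ring
end

section
/- Let F and E be finite fields with |E| = |F|², and let n ≥ 2 be an even integer. Then (2·|GL_{n/2}(E)|)³ ≥ |GL_n(F)|. Equivalently, the field-extension subgroup of GL_n(F) of type GL_{n/2}(q²), of order 2·|GL_{n/2}(E)| where q = |F|, is a large subgroup of GL_n(F). -/
theorem prod_range_two_mul_pow_sub_pow_le {q : ℕ} (hq : 0 < q) (N m : ℕ) :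
    ∏ i ∈ Finset.range (2 * m), (q ^ N - q ^ i) ≤
      (∏ i ∈ Finset.range m, (q ^ N - q ^ (2 * i))) ^ 2 := by
  induction m with
  | zero => simp
  | succ k ih =>
    rw [show 2 * (k + 1) = 2 * k + 1 + 1 by ring, Finset.prod_range_succ,
      Finset.prod_range_succ, Finset.prod_range_succ, mul_pow, mul_assoc,
      sq (q ^ N - q ^ (2 * k))]
    have h : q ^ N - q ^ (2 * k + 1) ≤ q ^ N - q ^ (2 * k) :=
      Nat.sub_le_sub_left (Nat.pow_le_pow_right hq (Nat.le_succ _)) _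
    gcongr

/-- `|GL_{2m}(F)| ≤ |GL_m(E)|²` when `|E| = |F|²`. -/
theorem card_GL_two_mul_le_sq (F E : Type*) [Field F] [Fintype F] [Field E] [Fintype E]
    (hFE : Fintype.card E = Fintype.card F ^ 2) (m : ℕ) :
    Nat.card (GL (Fin (2 * m)) F) ≤ Nat.card (GL (Fin m) E) ^ 2 := by
  rw [Matrix.card_GL_field, Matrix.card_GL_field, hFE,
    Fin.prod_univ_eq_prod_range
      (fun i => Fintype.card F ^ (2 * m) - Fintype.card F ^ i) (2 * m),
    Fin.prod_univ_eq_prod_range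
      (fun i => (Fintype.card F ^ 2) ^ m - (Fintype.card F ^ 2) ^ i) m]
  simp only [← pow_mul]
  exact prod_range_two_mul_pow_sub_pow_le Fintype.card_pos (2 * m) m

/-- For finite fields `F`, `E` with `|E| = |F|²` and even `n ≥ 2`,
`(2·|GL_{n/2}(E)|)³ ≥ |GL_n(F)|`: the field-extension subgroup of type
`GL_{n/2}(q²)` is a large subgroup of `GL_n(F)`. -/
theorem stmt_18 (F E : Type*) [Field F] [Fintype F] [Field E] [Fintype E]
    (hFE : Fintype.card E = Fintype.card F ^ 2)
    (n : ℕ) (hn : 2 ≤ n) (heven : Even n) :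
    Nat.card (GL (Fin n) F) ≤
      (2 * Nat.card (GL (Fin (n / 2)) E)) ^ 3 := by
  obtain ⟨m, rfl⟩ := heven.exists_two_nsmul
  rw [smul_eq_mul, Nat.mul_div_cancel_left m two_pos]
  have hpos : 0 < Nat.card (GL (Fin m) E) := Nat.card_pos
  calc Nat.card (GL (Fin (2 * m)) F)
      ≤ Nat.card (GL (Fin m) E) ^ 2 := card_GL_two_mul_le_sq F E hFE m
    _ ≤ (2 * Nat.card (GL (Fin m) E)) ^ 2 :=
      Nat.pow_le_pow_left (Nat.le_mul_of_pos_left _ two_pos) 2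
    _ ≤ (2 * Nat.card (GL (Fin m) E)) ^ 3 :=
      Nat.pow_le_pow_right (by positivity) (by norm_num)
end

section
/- Let F and E be finite fields with |E| = |F|², and let n ≥ 2 be an integer. Then |GL_n(F)|³ ≥ |GL_n(E)|. Equivalently, the subfield subgroup GL_n(q₀) of GL_n(q₀²), where q₀ = |F|, is a large subgroup. -/
/-- If `a ≥ 6` and `2 * b ≤ a`, then `a² - b² ≤ (a - b)³`. -/
theorem sq_sub_sq_le_sub_pow_three {a b : ℕ} (ha : 6 ≤ a) (hb : 2 * b ≤ a) :
    a ^ 2 - b ^ 2 ≤ (a - b) ^ 3 := by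
  obtain ⟨d, rfl⟩ : ∃ d, a = b + d := ⟨a - b, by omega⟩
  have hsq : (b + d) ^ 2 - b ^ 2 = d * (2 * b + d) := by
    rw [Nat.sub_eq_iff_eq_add (by nlinarith)]
    ring
  have hd : 2 * b + d ≤ d ^ 2 := by
    have hd3 : 3 ≤ d := by omega
    nlinarith
  rw [hsq, Nat.add_sub_cancel_left, pow_succ' d 2]
  exact Nat.mul_le_mul_left d hd

/-- The numerical inequality between the orders of `GL_n(q²)` and `GL_n(q)`. -/
theorem prod_sq_pow_sub_le_prod_pow_three {q n : ℕ} (hq : 2 ≤ q) (hn : 2 ≤ n) :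
    ∏ i : Fin n, ((q ^ 2) ^ n - (q ^ 2) ^ (i : ℕ)) ≤
      (∏ i : Fin n, (q ^ n - q ^ (i : ℕ))) ^ 3 := by
  by_cases h : 6 ≤ q ^ n
  · rw [← Finset.prod_pow]
    refine Finset.prod_le_prod' fun i _ ↦ ?_
    rw [pow_right_comm q 2 n, pow_right_comm q 2 i]
    refine sq_sub_sq_le_sub_pow_three h ?_
    calc 2 * q ^ (i : ℕ) ≤ q * q ^ (i : ℕ) := Nat.mul_le_mul_right _ hq
      _ = q ^ ((i : ℕ) + 1) := (pow_succ' q i).symm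
      _ ≤ q ^ n := Nat.pow_le_pow_right (by omega) i.isLt
  · have hq2 : q = 2 := by
      have := Nat.pow_le_pow_right (by omega : 0 < q) hn
      nlinarith
    subst hq2
    have hn2 : n = 2 := by
      by_contra hne
      have := Nat.pow_le_pow_right two_pos (by omega : 3 ≤ n)
      omega
    subst hn2
    decide

/-- For finite fields `F`, `E` with `|E| = |F|²` and `n ≥ 2`,
`|GL_n(F)|³ ≥ |GL_n(E)|`: the subfield subgroup `GL_n(q₀)` of `GL_n(q₀²)` is large. -/
theorem stmt_19 (F E : Type*) [Field F] [Fintype F] [Field E] [Fintype E]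
    (hFE : Fintype.card E = Fintype.card F ^ 2)
    (n : ℕ) (hn : 2 ≤ n) :
    Nat.card (GL (Fin n) E) ≤ Nat.card (GL (Fin n) F) ^ 3 := by
  rw [Matrix.card_GL_field, Matrix.card_GL_field, hFE]
  exact prod_sq_pow_sub_le_prod_pow_three Fintype.one_lt_card hn
end
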